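/- Fix n ≥ 2, w ∈ S_n, and k ∈ {1,…,n−1}. Then max_k(w) > 1 if and only if w has a 321-pattern or a 3412-pattern that straddles k in both position and value. -/

import Mathlib

/-- The simple reflection `σ_i = (i, i+1)`, acting on `ℕ` (1-indexed positions/values). -/
def simpleRefl (i : ℕ) : Equiv.Perm ℕ := Equiv.swap i (i + 1)

/-- `w` is a permutation of `{1, …, n}`: it fixes every point outside `[1, n]`. -/
def IsPermOf (n : ℕ) (w : Equiv.Perm ℕ) : Prop :=
  ∀ x : ℕ, x ∉ Finset.Icc 1 n → w x = x

/-- The Coxeter length of `w`: its number of inversions on `{1, …, n}`. -/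
def len (n : ℕ) (w : Equiv.Perm ℕ) : ℕ :=
  ((Finset.Icc 1 n ×ˢ Finset.Icc 1 n).filter fun p => p.1 < p.2 ∧ w p.2 < w p.1).card

/-- `L` is a word for `w`: a list of indices in `[1, n-1]` whose associated product of
simple reflections (read left to right) is `w`. -/
def IsWord (n : ℕ) (w : Equiv.Perm ℕ) (L : List ℕ) : Prop :=
  (∀ i ∈ L, 1 ≤ i ∧ i ≤ n - 1) ∧ (L.map simpleRefl).prod = w

/-- `L` is a reduced decomposition of `w`. -/
def IsReducedWord (n : ℕ) (w : Equiv.Perm ℕ) (L : List ℕ) : Prop :=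
  IsWord n w L ∧ L.length = len n w

/-- `min_k(w)`: the minimum number of occurrences of `σ_k` in a reduced decomposition of `w`. -/
noncomputable def minOcc (n k : ℕ) (w : Equiv.Perm ℕ) : ℕ :=
  sInf {m | ∃ L : List ℕ, IsReducedWord n w L ∧ L.count k = m}

/-- `max_k(w)`: the maximum number of occurrences of `σ_k` in a reduced decomposition of `w`. -/
noncomputable def maxOcc (n k : ℕ) (w : Equiv.Perm ℕ) : ℕ :=
  sSup {m | ∃ L : List ℕ, IsReducedWord n w L ∧ L.count k = m}

/-- `expat_k(w) = |{w(1),…,w(k)} ∩ {k+1,…,n}|`. -/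
def expat (n k : ℕ) (w : Equiv.Perm ℕ) : ℕ :=
  (((Finset.Icc 1 k).image fun i => w i) ∩ Finset.Icc (k + 1) n).card

/-- A `321`-pattern of `w` in positions `i1 < i2 < i3` (within `[1, n]`). -/
def Is321At (n : ℕ) (w : Equiv.Perm ℕ) (i1 i2 i3 : ℕ) : Prop :=
  1 ≤ i1 ∧ i1 < i2 ∧ i2 < i3 ∧ i3 ≤ n ∧ w i3 < w i2 ∧ w i2 < w i1

/-- A `3412`-pattern of `w` in positions `i1 < i2 < i3 < i4` (within `[1, n]`). -/
def Is3412At (n : ℕ) (w : Equiv.Perm ℕ) (i1 i2 i3 i4 : ℕ) : Prop :=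
  1 ≤ i1 ∧ i1 < i2 ∧ i2 < i3 ∧ i3 < i4 ∧ i4 ≤ n ∧
    w i3 < w i4 ∧ w i4 < w i1 ∧ w i1 < w i2

/-- `p` is a position pair at `k`: `p = (i1, i3)` for a `321`-pattern with `i1 ≤ k < i3`,
or `p = (i2, i3)` for a `3412`-pattern with `i2 ≤ k < i3`. -/
def IsPosPair (n k : ℕ) (w : Equiv.Perm ℕ) (p : ℕ × ℕ) : Prop :=
  (∃ i2, Is321At n w p.1 i2 p.2 ∧ p.1 ≤ k ∧ k < p.2) ∨
  (∃ i1 i4, Is3412At n w i1 p.1 p.2 i4 ∧ p.1 ≤ k ∧ k < p.2)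

/-- `p` is a value pair at `k`: `p = (j3, j1)` for a `321`-pattern with values
`j1 < j2 < j3` and `j1 ≤ k < j3`, or `p = (j4, j1)` for a `3412`-pattern with values
`j1 < j2 < j3 < j4` and `j2 ≤ k < j3`. -/
def IsValPair (n k : ℕ) (w : Equiv.Perm ℕ) (p : ℕ × ℕ) : Prop :=
  (∃ i1 i2 i3, Is321At n w i1 i2 i3 ∧ w i3 ≤ k ∧ k < w i1 ∧ p = (w i1, w i3)) ∨
  (∃ i1 i2 i3 i4, Is3412At n w i1 i2 i3 i4 ∧ w i4 ≤ k ∧ k < w i1 ∧ p = (w i2, w i3))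

/-- `PosPair_k(w)`: the number of distinct position pairs at `k` in `w`. -/
noncomputable def posPairCount (n k : ℕ) (w : Equiv.Perm ℕ) : ℕ :=
  Set.ncard {p : ℕ × ℕ | IsPosPair n k w p}

/-- `ValPair_k(w)`: the number of distinct value pairs at `k` in `w`. -/
noncomputable def valPairCount (n k : ℕ) (w : Equiv.Perm ℕ) : ℕ :=
  Set.ncard {p : ℕ × ℕ | IsValPair n k w p}

theorem sr_apply (i x : ℕ) : simpleRefl i x = if x = i then i + 1 else if x = i + 1 then i else x := by
  simp [simpleRefl, Equiv.swap_apply_def]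

theorem sr_left (i : ℕ) : simpleRefl i i = i + 1 := by simp [sr_apply]

theorem sr_right (i : ℕ) : simpleRefl i (i + 1) = i := by simp [sr_apply]

theorem sr_ne (i x : ℕ) (h : x ≠ i) (h' : x ≠ i + 1) : simpleRefl i x = x := by simp [sr_apply, h, h']

theorem sr_sr (i x : ℕ) : simpleRefl i (simpleRefl i x) = x := by simp [simpleRefl]

theorem sr_mul (i : ℕ) : simpleRefl i * simpleRefl i = 1 := by simp [simpleRefl]

theorem mul_sr_sr (w : Equiv.Perm ℕ) (i : ℕ) : w * simpleRefl i * simpleRefl i = w := by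
  rw [mul_assoc, sr_mul, mul_one]

theorem isPermOf_mul {n : ℕ} {w : Equiv.Perm ℕ} (hw : IsPermOf n w) {i : ℕ} (h1 : 1 ≤ i)
    (h2 : i ≤ n - 1) : IsPermOf n (w * simpleRefl i) := by
  intro x hx
  have : simpleRefl i x = x := by
    apply sr_ne <;> (rintro rfl; apply hx; rw [Finset.mem_Icc]; omega)
  rw [Equiv.Perm.mul_apply, this]
  exact hw x hx

theorem sr_mem {n i x : ℕ} (h1 : 1 ≤ i) (h2 : i ≤ n - 1) (hx : 1 ≤ x ∧ x ≤ n) :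
    1 ≤ simpleRefl i x ∧ simpleRefl i x ≤ n := by
  rw [sr_apply]; split_ifs <;> omega

theorem sr_lt {i p q : ℕ} (h : p < q) (h' : ¬ (p = i ∧ q = i + 1)) :
    simpleRefl i p < simpleRefl i q := by
  rw [sr_apply, sr_apply]; split_ifs <;> omega

theorem len_up {n : ℕ} {w : Equiv.Perm ℕ} {i : ℕ} (h1 : 1 ≤ i) (h2 : i ≤ n - 1)
    (h : w i < w (i + 1)) : len n (w * simpleRefl i) = len n w + 1 := by
  unfold len
  set f : ℕ × ℕ → ℕ × ℕ := fun p => (simpleRefl i p.1, simpleRefl i p.2) with hf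
  have hinj : Function.Injective f := by
    rintro ⟨a, b⟩ ⟨c, d⟩ hh
    simpa [hf] using hh
  rw [← Finset.card_image_of_injective ((Finset.Icc 1 n ×ˢ Finset.Icc 1 n).filter fun p => p.1 < p.2 ∧ w p.2 < w p.1) hinj,
    ← Finset.card_insert_of_notMem (a := (i, i + 1))]
  · congr 1
    ext ⟨p, q⟩
    simp only [Finset.mem_filter, Finset.mem_product, Finset.mem_Icc,
      Finset.mem_insert, Finset.mem_image, Prod.mk.injEq, Prod.exists, hf]
    simp only [Equiv.Perm.mul_apply]
    constructor
    · rintro ⟨⟨hp, hq⟩, hpq, hh⟩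
      by_cases hc : p = i ∧ q = i + 1
      · exact Or.inl hc
      · exact Or.inr ⟨simpleRefl i p, simpleRefl i q,
          ⟨⟨sr_mem h1 h2 hp, sr_mem h1 h2 hq⟩, sr_lt hpq hc, hh⟩, sr_sr _ _, sr_sr _ _⟩
    · rintro (⟨rfl, rfl⟩ | ⟨a, b, ⟨⟨ha, hb⟩, hab, hh⟩, rfl, rfl⟩)
      · rw [sr_left, sr_right]
        refine ⟨⟨by omega, by omega⟩, by omega, h⟩
      · rw [sr_sr, sr_sr]
        refine ⟨⟨sr_mem h1 h2 ha, sr_mem h1 h2 hb⟩, sr_lt hab ?_, hh⟩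
        rintro ⟨rfl, rfl⟩
        omega
  · simp only [Finset.mem_filter, Finset.mem_product, Finset.mem_Icc,
      Finset.mem_image, Prod.mk.injEq, Prod.exists, hf]
    rintro ⟨a, b, ⟨_, hab, _⟩, ha, hb⟩
    have ha' := sr_sr i a
    have hb' := sr_sr i b
    rw [ha, sr_left] at ha'
    rw [hb, sr_right] at hb'
    omega

theorem len_down {n : ℕ} {w : Equiv.Perm ℕ} {i : ℕ} (h1 : 1 ≤ i) (h2 : i ≤ n - 1)
    (h : w (i + 1) < w i) : len n w = len n (w * simpleRefl i) + 1 := by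
  have := len_up (n := n) (w := w * simpleRefl i) h1 h2
    (by rw [Equiv.Perm.mul_apply, Equiv.Perm.mul_apply, sr_left, sr_right]; exact h)
  rwa [mul_sr_sr] at this

theorem len_one' (n : ℕ) : len n 1 = 0 := by
  unfold len
  rw [Finset.card_eq_zero, Finset.filter_eq_empty_iff]
  rintro ⟨a, b⟩ _
  simp only [Equiv.Perm.one_apply]
  omega

theorem red_snoc {n : ℕ} {w : Equiv.Perm ℕ} {i : ℕ} (h1 : 1 ≤ i) (h2 : i ≤ n - 1)
    (h : w (i + 1) < w i) {L : List ℕ} (hL : IsReducedWord n (w * simpleRefl i) L) :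
    IsReducedWord n w (L ++ [i]) := by
  obtain ⟨⟨ha, hb⟩, hc⟩ := hL
  refine ⟨⟨?_, ?_⟩, ?_⟩
  · intro j hj
    rcases List.mem_append.1 hj with hj | hj
    · exact ha j hj
    · rw [List.mem_singleton] at hj; subst hj; exact ⟨h1, h2⟩
  · rw [List.map_append, List.prod_append, hb]
    simp [mul_sr_sr]
  · rw [List.length_append, hc, len_down h1 h2 h]; rfl

theorem eq_one_of_ascents {n : ℕ} {w : Equiv.Perm ℕ} (hw : IsPermOf n w)
    (h : ∀ i, 1 ≤ i → i ≤ n - 1 → w i < w (i + 1)) : w = 1 := by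
  have hout : ∀ x, x < 1 ∨ n < x → w x = x := fun x hx => hw x (by rw [Finset.mem_Icc]; omega)
  have hin : ∀ x, 1 ≤ x → x ≤ n → 1 ≤ w x ∧ w x ≤ n := by
    intro x hx hx'
    by_contra hc
    have := w.injective (hout (w x) (by omega))
    omega
  have hm : StrictMono w := by
    apply strictMono_nat_of_lt_succ
    intro x
    rcases Nat.lt_or_ge x 1 with hx | hx
    · have := hout x (Or.inl hx)
      rcases Nat.lt_or_ge n (x + 1) with hn | hn
      · have := hout (x + 1) (Or.inr hn); omega
      · have := hin (x + 1) (by omega) hn; omega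
    · rcases Nat.lt_or_ge n (x + 1) with hn | hn
      · have h3 := hout (x + 1) (Or.inr hn)
        rcases Nat.lt_or_ge n x with hn' | hn'
        · have := hout x (Or.inr hn'); omega
        · have := hin x hx hn'; omega
      · exact h x hx (by omega)
  ext x
  have h1 := hm.le_apply (x := x)
  have h2 : w x ≤ x := by
    by_contra hc
    have hm' : StrictMono w.symm := by
      intro a b hab
      rw [← hm.lt_iff_lt]; simpa using hab
    have := hm'.le_apply (x := w x)
    rw [Equiv.symm_apply_apply] at this
    omega
  simp only [Equiv.Perm.one_apply]
  omega

theorem exists_red {n : ℕ} : ∀ d : ℕ, ∀ w : Equiv.Perm ℕ, IsPermOf n w → len n w = d →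
    ∃ L, IsReducedWord n w L := by
  intro d
  induction d using Nat.strong_induction_on with
  | _ d ih =>
    intro w hw hd
    by_cases h : ∀ i, 1 ≤ i → i ≤ n - 1 → w i < w (i + 1)
    · have := eq_one_of_ascents hw h
      subst this
      exact ⟨[], ⟨by simp, by simp⟩, by simp [len_one']⟩
    · push Not at h
      obtain ⟨i, h1, h2, h3⟩ := h
      have h3 : w (i + 1) < w i := by
        refine lt_of_le_of_ne h3 fun hc => ?_
        have := w.injective hc
        omega
      have hlen := len_down h1 h2 h3
      obtain ⟨L, hL⟩ := ih (len n (w * simpleRefl i)) (by omega) _ (isPermOf_mul hw h1 h2) rfl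
      exact ⟨_, red_snoc h1 h2 h3 hL⟩

theorem word_le {k : ℕ} (L : List ℕ) (h : k ∉ L) (x : ℕ) :
    ((L.map simpleRefl).prod x ≤ k ↔ x ≤ k) := by
  induction L generalizing x with
  | nil => simp
  | cons a L ih =>
    simp only [List.mem_cons, not_or] at h
    rw [List.map_cons, List.prod_cons, Equiv.Perm.mul_apply, ← ih h.2 x, sr_apply]
    split_ifs <;> omega

theorem final_step {n k : ℕ} {w : Equiv.Perm ℕ} (hw : IsPermOf n w) (hk1 : 1 ≤ k)
    (hk2 : k ≤ n - 1) (h : w (k + 1) < w k) (x : ℕ) (hx : x ≠ k) (hx' : x ≠ k + 1)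
    (hh : ¬ (w x ≤ k ↔ x ≤ k)) : ∃ L, IsReducedWord n w L ∧ 2 ≤ L.count k := by
  obtain ⟨L, hL⟩ := exists_red _ _ (isPermOf_mul hw hk1 hk2) rfl
  refine ⟨_, red_snoc hk1 hk2 h hL, ?_⟩
  have : k ∈ L := by
    by_contra hc
    have h3 := word_le L hc x
    rw [hL.1.2, Equiv.Perm.mul_apply, sr_ne _ _ hx hx'] at h3
    exact hh h3
  have := List.count_pos_iff.2 this
  rw [List.count_append, List.count_singleton_self]
  omega

theorem sort_step {n k : ℕ} (hk1 : 1 ≤ k) (hk2 : k ≤ n - 1) : ∀ d : ℕ, ∀ (w : Equiv.Perm ℕ)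
    (x p q : ℕ), IsPermOf n w → 1 ≤ p → p ≤ k → k < q → q ≤ n → w q < w p →
    (x < p ∨ q < x) → ¬ (w x ≤ k ↔ x ≤ k) → (k - p) + (q - (k + 1)) = d →
    ∃ L, IsReducedWord n w L ∧ 2 ≤ L.count k := by
  intro d
  induction d with
  | zero =>
    intro w x p q hw hp1 hpk hkq hqn hlt hx hh hd
    obtain rfl : p = k := by omega
    obtain rfl : q = p + 1 := by omega
    exact final_step hw hk1 hk2 hlt x (by omega) (by omega) hh
  | succ d ih =>
    intro w x p q hw hp1 hpk hkq hqn hlt hx hh hd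
    by_cases hp : p < k
    · by_cases hc : w (p + 1) < w p
      · obtain ⟨L, hL, hL2⟩ := ih (w * simpleRefl p) x (p + 1) q
          (isPermOf_mul hw hp1 (by omega)) (by omega) (by omega) hkq hqn
          (by rw [Equiv.Perm.mul_apply, Equiv.Perm.mul_apply, sr_right,
                sr_ne _ _ (by omega) (by omega)]; exact hlt) (by omega)
          (by rw [Equiv.Perm.mul_apply, sr_ne _ _ (by omega) (by omega)]; exact hh) (by omega)
        refine ⟨_, red_snoc hp1 (by omega) hc hL, ?_⟩
        rw [List.count_append]; omega
      · exact ih w x (p + 1) q hw (by omega) (by omega) hkq hqn (by omega) (by omega) hh (by omega)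
    · obtain ⟨r, rfl⟩ : ∃ r, q = r + 1 := ⟨q - 1, by omega⟩
      by_cases hc : w (r + 1) < w r
      · obtain ⟨L, hL, hL2⟩ := ih (w * simpleRefl r) x p r
          (isPermOf_mul hw (by omega) (by omega)) hp1 hpk (by omega) (by omega)
          (by rw [Equiv.Perm.mul_apply, Equiv.Perm.mul_apply, sr_left,
                sr_ne _ _ (by omega) (by omega)]; exact hlt) (by omega)
          (by rw [Equiv.Perm.mul_apply, sr_ne _ _ (by omega) (by omega)]; exact hh) (by omega)
        refine ⟨_, red_snoc (by omega) (by omega) hc hL, ?_⟩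
        rw [List.count_append]; omega
      · exact ih w x p r hw hp1 hpk (by omega) (by omega) (by omega) (by omega) hh (by omega)

/-- Straddling pattern property. -/
def PatP (n k : ℕ) (w : Equiv.Perm ℕ) : Prop :=
  (∃ i1 i2 i3, Is321At n w i1 i2 i3 ∧ i1 ≤ k ∧ k < i3 ∧ w i3 ≤ k ∧ k < w i1) ∨
  (∃ i1 i2 i3 i4, Is3412At n w i1 i2 i3 i4 ∧ i2 ≤ k ∧ k < i3 ∧ w i4 ≤ k ∧ k < w i1)

theorem patP_word {n k : ℕ} {w : Equiv.Perm ℕ} (hw : IsPermOf n w) (hk1 : 1 ≤ k)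
    (hk2 : k ≤ n - 1) (h : PatP n k w) : ∃ L, IsReducedWord n w L ∧ 2 ≤ L.count k := by
  rcases h with ⟨i1, i2, i3, ⟨h1, h2, h3, h4, h5, h6⟩, h7, h8, h9, h10⟩ |
    ⟨i1, i2, i3, i4, ⟨h1, h2, h3, h4, h5, h6, h7, h8⟩, h9, h10, h11, h12⟩
  · by_cases hc : i2 ≤ k
    · exact sort_step hk1 hk2 _ w i1 i2 i3 hw (by omega) hc h8 h4 h5 (by omega) (by omega) rfl
    · exact sort_step hk1 hk2 _ w i3 i1 i2 hw (by omega) h7 (by omega) (by omega) h6 (by omega)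
        (by omega) rfl
  · exact sort_step hk1 hk2 _ w i1 i2 i3 hw (by omega) (by omega) (by omega) (by omega) (by omega)
      (by omega) (by omega) rfl

/-- Crossing property. -/
def CrossE (n k : ℕ) (w : Equiv.Perm ℕ) : Prop :=
  ∃ p q, 1 ≤ p ∧ p ≤ k ∧ k < q ∧ q ≤ n ∧ k < w p ∧ w q ≤ k

theorem crossE_up {n k : ℕ} {w : Equiv.Perm ℕ} {i : ℕ} (h1 : 1 ≤ i) (h2 : i ≤ n - 1)
    (h : w i < w (i + 1)) (hE : CrossE n k w) : CrossE n k (w * simpleRefl i) := by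
  obtain ⟨p, q, a1, a2, a3, a4, a5, a6⟩ := hE
  by_cases hik : i = k
  · subst hik
    by_cases hp : p = i
    · subst hp
      refine ⟨p, q, a1, a2, a3, a4, ?_, ?_⟩
      · rw [Equiv.Perm.mul_apply, sr_left]; omega
      · have : q ≠ p + 1 := by rintro rfl; omega
        rw [Equiv.Perm.mul_apply, sr_ne _ _ (by omega) this]; exact a6
    · refine ⟨p, q, a1, a2, a3, a4, ?_, ?_⟩
      · rw [Equiv.Perm.mul_apply, sr_ne _ _ (by omega) (by omega)]; exact a5
      · by_cases hq : q = i + 1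
        · subst hq
          rw [Equiv.Perm.mul_apply, sr_right]; omega
        · rw [Equiv.Perm.mul_apply, sr_ne _ _ (by omega) hq]; exact a6
  · refine ⟨simpleRefl i p, simpleRefl i q, (sr_mem h1 h2 ⟨a1, by omega⟩).1, ?_, ?_,
      (sr_mem h1 h2 ⟨by omega, a4⟩).2, ?_, ?_⟩
    · rw [sr_apply]; split_ifs <;> omega
    · rw [sr_apply]; split_ifs <;> omega
    · rw [Equiv.Perm.mul_apply, sr_sr]; exact a5
    · rw [Equiv.Perm.mul_apply, sr_sr]; exact a6

theorem patP_of_crossE {n k : ℕ} {w : Equiv.Perm ℕ} (h1 : 1 ≤ k) (h2 : k ≤ n - 1)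
    (h : w k < w (k + 1)) (hE : CrossE n k w) : PatP n k (w * simpleRefl k) := by
  obtain ⟨p, q, a1, a2, a3, a4, a5, a6⟩ := hE
  have el : (w * simpleRefl k) k = w (k + 1) := by rw [Equiv.Perm.mul_apply, sr_left]
  have er : (w * simpleRefl k) (k + 1) = w k := by rw [Equiv.Perm.mul_apply, sr_right]
  have en : ∀ x, x ≠ k → x ≠ k + 1 → (w * simpleRefl k) x = w x := fun x hx hx' => by
    rw [Equiv.Perm.mul_apply, sr_ne _ _ hx hx']
  by_cases c1 : k < w k
  · have hq : q ≠ k + 1 := by rintro rfl; omega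
    have eq := en q (by omega) hq
    exact Or.inl ⟨k, k + 1, q, ⟨h1, by omega, by omega, a4, by omega, by omega⟩, by omega,
      by omega, by omega, by omega⟩
  have hpk : p ≠ k := by rintro rfl; omega
  have ep := en p hpk (by omega)
  by_cases c2 : w (k + 1) ≤ k
  · exact Or.inl ⟨p, k, k + 1, ⟨a1, by omega, by omega, by omega, by omega, by omega⟩, by omega,
      by omega, by omega, by omega⟩
  have hq : q ≠ k + 1 := by rintro rfl; omega
  have eq := en q (by omega) hq
  have n1 : w p ≠ w (k + 1) := fun hc => by have := w.injective hc; omega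
  have n2 : w q ≠ w k := fun hc => by have := w.injective hc; omega
  by_cases c3 : w (k + 1) < w p
  · exact Or.inl ⟨p, k, q, ⟨a1, by omega, by omega, by omega, by omega, by omega⟩, by omega,
      by omega, by omega, by omega⟩
  by_cases c4 : w q < w k
  · exact Or.inl ⟨p, k + 1, q, ⟨a1, by omega, by omega, by omega, by omega, by omega⟩, by omega,
      by omega, by omega, by omega⟩
  exact Or.inr ⟨p, k, k + 1, q, ⟨a1, by omega, by omega, by omega, by omega, by omega, by omega,
    by omega⟩, by omega, by omega, by omega, by omega⟩

theorem patP_up {n k : ℕ} {w : Equiv.Perm ℕ} {i : ℕ} (h1 : 1 ≤ i) (h2 : i ≤ n - 1)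
    (h : w i < w (i + 1)) (hP : PatP n k w) : PatP n k (w * simpleRefl i) := by
  by_cases hik : i = k
  · subst hik
    apply patP_of_crossE h1 h2 h
    rcases hP with ⟨i1, i2, i3, ⟨h1, h2, h3, h4, h5, h6⟩, h7, h8, h9, h10⟩ |
      ⟨i1, i2, i3, i4, ⟨h1, h2, h3, h4, h5, h6, h7, h8⟩, h9, h10, h11, h12⟩
    · exact ⟨i1, i3, by omega, by omega, by omega, by omega, by omega, by omega⟩
    · exact ⟨i1, i4, by omega, by omega, by omega, by omega, by omega, by omega⟩
  have ew : ∀ x, (w * simpleRefl i) (simpleRefl i x) = w x := fun x => by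
    rw [Equiv.Perm.mul_apply, sr_sr]
  have inv : ∀ {a b}, a < b → w b < w a → simpleRefl i a < simpleRefl i b := fun hab hw =>
    sr_lt hab (by rintro ⟨rfl, rfl⟩; omega)
  have le1 : ∀ x, x ≤ k → simpleRefl i x ≤ k := fun x hx => by
    rw [sr_apply]; split_ifs <;> omega
  have le2 : ∀ x, k < x → k < simpleRefl i x := fun x hx => by
    rw [sr_apply]; split_ifs <;> omega
  rcases hP with ⟨i1, i2, i3, ⟨b1, b2, b3, b4, b5, b6⟩, b7, b8, b9, b10⟩ |
    ⟨i1, i2, i3, i4, ⟨b1, b2, b3, b4, b5, b6, b7, b8⟩, b9, b10, b11, b12⟩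
  · refine Or.inl ⟨simpleRefl i i1, simpleRefl i i2, simpleRefl i i3,
      ⟨(sr_mem h1 h2 ⟨b1, by omega⟩).1, inv b2 b6, inv b3 b5, (sr_mem h1 h2 ⟨by omega, b4⟩).2,
        ?_, ?_⟩, le1 _ b7, le2 _ b8, ?_, ?_⟩ <;> simpa only [ew]
  · by_cases c1 : i1 = i ∧ i2 = i + 1
    · obtain ⟨rfl, rfl⟩ := c1
      have s3 := ew i3
      have s1 := ew i1
      have s2 := ew (i1 + 1)
      rw [sr_left] at s1
      rw [sr_right] at s2
      have t3 : simpleRefl i1 i3 = i3 := sr_ne _ _ (by omega) (by omega)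
      rw [t3] at s3
      exact Or.inl ⟨i1, i1 + 1, i3, ⟨b1, by omega, by omega, by omega, by omega, by omega⟩,
        by omega, by omega, by omega, by omega⟩
    by_cases c2 : i3 = i ∧ i4 = i + 1
    · obtain ⟨rfl, rfl⟩ := c2
      have s1 := ew i1
      have s3 := ew i3
      have s4 := ew (i3 + 1)
      rw [sr_left] at s3
      rw [sr_right] at s4
      have t1 : simpleRefl i3 i1 = i1 := sr_ne _ _ (by omega) (by omega)
      rw [t1] at s1
      exact Or.inl ⟨i1, i3, i3 + 1, ⟨b1, by omega, by omega, by omega, by omega, by omega⟩,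
        by omega, by omega, by omega, by omega⟩
    refine Or.inr ⟨simpleRefl i i1, simpleRefl i i2, simpleRefl i i3, simpleRefl i i4,
      ⟨(sr_mem h1 h2 ⟨b1, by omega⟩).1, sr_lt b2 c1, inv b3 (by omega), sr_lt b4 c2,
        (sr_mem h1 h2 ⟨by omega, b5⟩).2, ?_, ?_, ?_⟩, le1 _ b9, le2 _ b10, ?_, ?_⟩ <;>
      simpa only [ew]

theorem word_patP {n k : ℕ} (L : List ℕ) : (∀ i ∈ L, 1 ≤ i ∧ i ≤ n - 1) →
    len n (L.map simpleRefl).prod ≤ L.length ∧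
    (L.length = len n (L.map simpleRefl).prod →
      (k ∈ L → CrossE n k (L.map simpleRefl).prod) ∧
      (2 ≤ L.count k → PatP n k (L.map simpleRefl).prod)) := by
  induction L using List.reverseRecOn with
  | nil => intro _; simp [len_one']
  | append_singleton L i ih =>
    intro hL
    obtain ⟨ih1, ih2⟩ := ih (fun j hj => hL j (List.mem_append_left _ hj))
    obtain ⟨h1, h2⟩ := hL i (by simp)
    have e : ((L ++ [i]).map simpleRefl).prod = (L.map simpleRefl).prod * simpleRefl i := by simp
    rw [e, List.length_append, List.length_singleton]
    have hk := word_le (k := k) L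
    generalize (L.map simpleRefl).prod = w at *
    rcases Nat.lt_or_ge (w i) (w (i + 1)) with hlt | hge
    · have hl := len_up h1 h2 hlt
      refine ⟨by omega, fun hlen => ?_⟩
      obtain ⟨ih3, ih4⟩ := ih2 (by omega)
      constructor
      · intro hkm
        by_cases hkL : k ∈ L
        · exact crossE_up h1 h2 hlt (ih3 hkL)
        · have hki : k = i := by simpa [hkL] using hkm
          subst hki
          have a := hk hkL k
          have b := hk hkL (k + 1)
          refine ⟨k, k + 1, h1, le_rfl, by omega, by omega, ?_, ?_⟩
          · rw [Equiv.Perm.mul_apply, sr_left]; omega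
          · rw [Equiv.Perm.mul_apply, sr_right]; omega
      · intro hc
        by_cases h3 : 2 ≤ L.count k
        · exact patP_up h1 h2 hlt (ih4 h3)
        · rw [List.count_append] at hc
          have hki : k = i := by
            by_contra hne
            have : List.count k [i] = 0 := List.count_eq_zero.2 (by simpa using hne)
            omega
          subst hki
          rw [List.count_singleton_self] at hc
          exact patP_of_crossE h1 h2 hlt (ih3 (List.count_pos_iff.1 (by omega)))
    · have hlt : w (i + 1) < w i := by
        refine lt_of_le_of_ne hge fun hc => ?_
        have := w.injective hc
        omega
      have := len_down h1 h2 hlt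
      exact ⟨by omega, fun hlen => by omega⟩

/-- Theorem: `max_k(w) > 1`. `max_k(w) > 1` if and only if `w` has
a `321`-pattern or a `3412`-pattern that straddles `k` in both position and value. -/
theorem maxOcc_gt_one_iff_straddling (n : ℕ) (hn : 2 ≤ n) (w : Equiv.Perm ℕ)
    (hw : IsPermOf n w) (k : ℕ) (hk1 : 1 ≤ k) (hk2 : k ≤ n - 1) :
    1 < maxOcc n k w ↔
      ((∃ i1 i2 i3, Is321At n w i1 i2 i3 ∧ i1 ≤ k ∧ k < i3 ∧ w i3 ≤ k ∧ k < w i1) ∨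
       (∃ i1 i2 i3 i4, Is3412At n w i1 i2 i3 i4 ∧ i2 ≤ k ∧ k < i3 ∧
          w i4 ≤ k ∧ k < w i1)) := by
  change 1 < maxOcc n k w ↔ PatP n k w
  have hb : BddAbove {m | ∃ L : List ℕ, IsReducedWord n w L ∧ L.count k = m} := by
    refine ⟨len n w, ?_⟩
    rintro m ⟨L, hL, rfl⟩
    rw [← hL.2]
    exact List.count_le_length
  constructor
  · intro h
    obtain ⟨L0, hL0⟩ := exists_red _ w hw rfl
    have hne : {m | ∃ L : List ℕ, IsReducedWord n w L ∧ L.count k = m}.Nonempty :=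
      ⟨_, L0, hL0, rfl⟩
    obtain ⟨m, ⟨L, hL, rfl⟩, hm⟩ := exists_lt_of_lt_csSup hne h
    have := (word_patP (n := n) (k := k) L hL.1.1).2
    rw [hL.1.2] at this
    exact (this hL.2).2 hm
  · intro h
    obtain ⟨L, hL, h2⟩ := patP_word hw hk1 hk2 h
    exact lt_of_lt_of_le h2 (le_csSup hb ⟨L, hL, rfl⟩)
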